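/- Let K be a field of characteristic 0 whose maximal abelian subextension K_ab over ℚ is finite. Then K and K_ab have the same Chevalley-Bass number. -/

import Mathlib

noncomputable section

/-- The maximal abelian subextension of `K/ℚ`: the compositum of all subextensions of `K/ℚ`
which are Galois over `ℚ` with abelian Galois group. -/
def maxAb (K : Type*) [Field K] [CharZero K] : IntermediateField ℚ K :=
  ⨆ F ∈ {F : IntermediateField ℚ K |
      IsGalois ℚ ↥F ∧ ∀ σ τ : ↥F ≃ₐ[ℚ] ↥F, σ * τ = τ * σ}, F

/-- The set of positive integers `Λ` satisfying the Chevalley–Bass property for the field `F`: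
for every `n > 0`, `(F(ζ_{Λn})ˣ)^{Λn} ∩ Fˣ ⊆ (Fˣ)ⁿ`, where `F(ζ_{Λn})` is the field obtained
by adjoining all `Λn`-th roots of unity inside the algebraically closed extension `Ω`. -/
def cbSet (F Ω : Type*) [Field F] [Field Ω] [Algebra F Ω] : Set ℕ :=
  {Λ | 0 < Λ ∧ ∀ n : ℕ, 0 < n → ∀ x : F, x ≠ 0 →
    (∃ y ∈ IntermediateField.adjoin F {z : Ω | z ^ (Λ * n) = 1},
        y ^ (Λ * n) = algebraMap F Ω x) →
    ∃ z : F, z ^ n = x}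

/-- The Chevalley–Bass number of a field `F` (computed inside an algebraic closure `Ω`):
the smallest positive integer in `cbSet F Ω`. -/
def chevalleyBass (F Ω : Type*) [Field F] [Field Ω] [Algebra F Ω] : ℕ :=
  sInf (cbSet F Ω)

/-- The number of roots of unity contained in a field `F`. -/
def numRootsOfUnity (F : Type*) [Field F] : ℕ :=
  Nat.card (CommGroup.torsion Fˣ)

/-- The conductor of the maximal abelian subextension of `K/ℚ`: the smallest positive `f`
such that `K_ab ⊆ ℚ(ζ_f)` inside the algebraic closure `Ω`. -/
def conductorAb (K Ω : Type*) [Field K] [CharZero K] [Field Ω] [Algebra K Ω]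
    [Algebra ℚ Ω] [IsScalarTower ℚ K Ω] : ℕ :=
  sInf {f | 0 < f ∧ (maxAb K).map (IsScalarTower.toAlgHom ℚ K Ω)
    ≤ IntermediateField.adjoin ℚ {z : Ω | z ^ f = 1}}

end

theorem isAbelianGalois_iSup {F E ι : Type*} [Field F] [Field E] [Algebra F E]
    (t : ι → IntermediateField F E) [∀ i, IsAbelianGalois F (t i)] :
    IsAbelianGalois F ↥(⨆ i, t i) where
  is_comm.comm σ τ := by
    suffices h : ((σ * τ : Gal(↥(⨆ i, t i)/F)) : ↥(⨆ i, t i) →ₐ[F] ↥(⨆ i, t i)) =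
        ((τ * σ : Gal(↥(⨆ i, t i)/F)) : ↥(⨆ i, t i) →ₐ[F] ↥(⨆ i, t i)) from
      AlgEquiv.ext fun x => DFunLike.congr_fun h x
    refine IntermediateField.algHom_ext_of_eq_adjoin _
      (IntermediateField.iSup_eq_adjoin _ _) fun x hx => ?_
    obtain ⟨i, hi⟩ := Set.mem_iUnion.mp hx
    let _ := (IntermediateField.inclusion (le_iSup t i)).toRingHom.toAlgebra
    have : IsScalarTower F (t i) ↥(⨆ i, t i) := .of_algebraMap_eq fun _ => rfl
    have hσ := σ.restrictNormal_commutes (t i)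
    have hτ := τ.restrictNormal_commutes (t i)
    change σ (τ (algebraMap (t i) _ ⟨x, hi⟩)) = τ (σ (algebraMap (t i) _ ⟨x, hi⟩))
    rw [← hτ, ← hσ, ← hσ, ← hτ]
    exact congrArg _ (DFunLike.congr_fun
      (IsMulCommutative.is_comm.comm (σ.restrictNormal (t i)) (τ.restrictNormal (t i))) _)

theorem isAbelianGalois_sup {F E : Type*} [Field F] [Field E] [Algebra F E]
    (A B : IntermediateField F E) [IsAbelianGalois F A] [IsAbelianGalois F B] :
    IsAbelianGalois F ↥(A ⊔ B) := by
  rw [sup_eq_iSup]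
  have : ∀ b : Bool, IsAbelianGalois F ↥(cond b A B) := by
    rintro (_ | _) <;> assumption
  exact isAbelianGalois_iSup _

/-- The compositum of all abelian Galois subextensions of `E/F`. -/
def maxAbelian (F E : Type*) [Field F] [Field E] [Algebra F E] : IntermediateField F E :=
  ⨆ A : {A : IntermediateField F E // IsAbelianGalois F A}, A.1

instance isAbelianGalois_maxAbelian (F E : Type*) [Field F] [Field E] [Algebra F E] :
    IsAbelianGalois F (maxAbelian F E) :=
  have (A : {A : IntermediateField F E // IsAbelianGalois F A}) : IsAbelianGalois F A.1 := A.2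
  isAbelianGalois_iSup _

theorem le_maxAbelian {F E : Type*} [Field F] [Field E] [Algebra F E]
    (A : IntermediateField F E) [hA : IsAbelianGalois F A] : A ≤ maxAbelian F E :=
  le_iSup (fun A : {A : IntermediateField F E // IsAbelianGalois F A} => A.1) ⟨A, hA⟩

theorem isAbelianGalois_iff {F E : Type*} [Field F] [Field E] [Algebra F E] :
    IsAbelianGalois F E ↔ IsGalois F E ∧ ∀ σ τ : E ≃ₐ[F] E, σ * τ = τ * σ :=
  ⟨fun h => ⟨h.toIsGalois, h.is_comm.comm⟩, fun h => { h.1 with is_comm := ⟨h.2⟩ }⟩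

theorem maxAb_eq_maxAbelian (K : Type*) [Field K] [CharZero K] :
    maxAb K = maxAbelian ℚ K := by
  rw [maxAb, maxAbelian, iSup_subtype]
  refine iSup_congr fun A => iSup_congr_Prop ?_ fun _ => rfl
  rw [Set.mem_ofPred_eq, ← isAbelianGalois_iff]
  congr!

theorem isCyclotomicExtension_adjoin_pow_eq_one (K Ω : Type*) [Field K] [CharZero K] [Field Ω]
    [Algebra K Ω] [IsAlgClosed Ω] {N : ℕ} (hN : 0 < N) :
    IsCyclotomicExtension {N} K (IntermediateField.adjoin K {z : Ω | z ^ N = 1}) := by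
  have : CharZero Ω := charZero_of_injective_algebraMap (algebraMap K Ω).injective
  have : NeZero (N : Ω) := ⟨by exact_mod_cast hN.ne'⟩
  have h := IntermediateField.isCyclotomicExtension_adjoin_of_exists_isPrimitiveRoot {N} K Ω
    (by rintro n rfl -; exact HasEnoughRootsOfUnity.exists_primitiveRoot Ω n)
  have hset : {z : Ω | z ^ N = 1} = {z | ∃ n ∈ ({N} : Set ℕ), n ≠ 0 ∧ z ^ n = 1} := by
    ext; simp [hN.ne']
  rwa [hset]

theorem mem_maxAbelian_of_mem_adjoin {F K Ω : Type*} [Field F] [CharZero F] [Field K] [Field Ω]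
    [Algebra F K] [Algebra F Ω] [Algebra K Ω] [IsScalarTower F K Ω] [IsAlgClosed Ω]
    {N : ℕ} (hN : 0 < N) {a : K}
    (ha : algebraMap K Ω a ∈ IntermediateField.adjoin (maxAbelian F K) {z : Ω | z ^ N = 1}) :
    a ∈ maxAbelian F K := by
  let f : K →ₐ[F] Ω := IsScalarTower.toAlgHom F K Ω
  let C := IntermediateField.adjoin F {z : Ω | z ^ N = 1}
  have : IsCyclotomicExtension {N} F C := isCyclotomicExtension_adjoin_pow_eq_one F Ω hN
  have : IsAbelianGalois F C := IsCyclotomicExtension.isAbelianGalois {N} F C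
  have : IsAbelianGalois F ((maxAbelian F K).map f) :=
    .of_algHom ((maxAbelian F K).equivMap f).symm.toAlgHom
  let M := (maxAbelian F K).map f ⊔ C
  have : IsAbelianGalois F M := isAbelianGalois_sup _ _
  have : IsAbelianGalois F (M.comap f) :=
    .of_algHom (M := M)
      ((f.comp (M.comap f).val).codRestrict M.toSubalgebra fun x => x.2)
  refine le_maxAbelian (M.comap f) ?_
  change algebraMap K Ω a ∈ M.toSubfield
  refine (IntermediateField.adjoin_le_subfield _ _ ?_ ?_ : _ ≤ M.toSubfield) ha
  · rintro _ ⟨x, rfl⟩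
    exact (le_sup_left : _ ≤ M) ⟨x, x.2, rfl⟩
  · exact fun z hz => (le_sup_right : _ ≤ M) (IntermediateField.subset_adjoin _ _ hz)

theorem exists_trace_mul_ne_zero {K L : Type*} [Field K] [Field L] [Algebra K L]
    [FiniteDimensional K L] [Algebra.IsSeparable K L] {S : Submonoid L}
    (hS : Algebra.adjoin K (S : Set L) = ⊤) {y : L} (hy : y ≠ 0) :
    ∃ c ∈ S, Algebra.trace K L (y * c) ≠ 0 := by
  by_contra! h
  have : Algebra.traceForm K L y = 0 := by
    have hspan : Submodule.span K (S : Set L) = ⊤ := by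
      conv_lhs => rw [← Submonoid.closure_eq S]
      rw [← Algebra.adjoin_eq_span, hS, Algebra.top_toSubmodule]
    exact LinearMap.ext_on hspan fun c hc => h c hc
  exact hy ((traceForm_nondegenerate K L).1 y fun z => by rw [this]; rfl)

theorem IsCyclotomicExtension.exists_div_mem_closure {K L : Type*} [Field K] [CharZero K]
    [Field L] [Algebra K L] {N : ℕ} [IsCyclotomicExtension {N} K L]
    {x : K} {y : L} (hy : y ≠ 0) (hxy : y ^ N = algebraMap K L x) :
    ∃ t : K, t ≠ 0 ∧ algebraMap K L t / y ∈ AddSubmonoid.closure {z : L | z ^ N = 1} := by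
  have := IsCyclotomicExtension.isGalois {N} K L
  have := IsCyclotomicExtension.finiteDimensional {N} K L
  have hS : Algebra.adjoin K (MonoidHom.mker (powMonoidHom N : L →* L) : Set L) = ⊤ := by
    rw [eq_top_iff, ← ((IsCyclotomicExtension.iff_adjoin_eq_top {N} K L).1 ‹_›).2]
    refine Algebra.adjoin_mono ?_
    rintro b ⟨n, rfl, -, hb⟩
    exact hb
  obtain ⟨c, hc, ht⟩ := exists_trace_mul_ne_zero hS hy
  refine ⟨_, ht, ?_⟩
  rw [trace_eq_sum_automorphisms, Finset.sum_div]
  refine sum_mem fun σ _ => AddSubmonoid.subset_closure ?_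
  have hc : c ^ N = 1 := hc
  have hx : algebraMap K L x ≠ 0 := hxy ▸ pow_ne_zero N hy
  simp [div_pow, mul_pow, ← map_pow, hxy, hc, hx]

theorem cbSet_eq_of_tower (k K Ω : Type*) [Field k] [Field K] [CharZero K] [Field Ω]
    [Algebra k K] [Algebra k Ω] [Algebra K Ω] [IsScalarTower k K Ω] [IsAlgClosed Ω]
    (h : ∀ N : ℕ, 0 < N → ∀ a : K,
      algebraMap K Ω a ∈ IntermediateField.adjoin k {z : Ω | z ^ N = 1} →
        ∃ b : k, algebraMap k K b = a) :
    cbSet K Ω = cbSet k Ω := by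
  ext Λ
  refine and_congr_right fun hΛ => forall₂_congr fun n hn => ?_
  have hN : 0 < Λ * n := Nat.mul_pos hΛ hn
  constructor
  · rintro H x hx ⟨y, hy, hxy⟩
    rw [IsScalarTower.algebraMap_apply k K Ω] at hxy
    have hle : IntermediateField.adjoin k {z : Ω | z ^ (Λ * n) = 1} ≤
        (IntermediateField.adjoin K {z : Ω | z ^ (Λ * n) = 1}).restrictScalars k :=
      IntermediateField.adjoin_le_iff.2 (IntermediateField.subset_adjoin K _)
    obtain ⟨z, hz⟩ := H (algebraMap k K x) (by simpa using hx) ⟨y, hle hy, hxy⟩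
    have hx' : algebraMap K Ω (algebraMap k K x) ≠ 0 := by simpa using hx
    have hy0 : y ≠ 0 := by
      rintro rfl
      exact hx' (by rw [← hxy, zero_pow hN.ne'])
    obtain ⟨b, hb⟩ := h (Λ * n) hN z <| by
      have hmem : algebraMap K Ω z / y ^ Λ ∈
          IntermediateField.adjoin k {z : Ω | z ^ (Λ * n) = 1} := by
        refine IntermediateField.subset_adjoin k _ ?_
        have : (algebraMap K Ω z / y ^ Λ) ^ n = 1 := by
          rw [div_pow, ← map_pow, hz, ← pow_mul, hxy, div_self hx']
        rw [Set.mem_ofPred_eq, mul_comm, pow_mul, this, one_pow]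
      simpa [hy0] using mul_mem hmem (pow_mem hy Λ)
    exact ⟨b, (algebraMap k K).injective (by rw [map_pow, hb, hz])⟩
  · rintro H x hx ⟨y, hy, hxy⟩
    have := isCyclotomicExtension_adjoin_pow_eq_one K Ω hN
    have hx' : algebraMap K Ω x ≠ 0 := by simpa using hx
    have hy0 : y ≠ 0 := by
      rintro rfl
      exact hx' (by rw [← hxy, zero_pow hN.ne'])
    obtain ⟨t, ht, htmem⟩ := IsCyclotomicExtension.exists_div_mem_closure (x := x)
      (y := (⟨y, hy⟩ : IntermediateField.adjoin K {z : Ω | z ^ (Λ * n) = 1}))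
      (by simpa [Subtype.ext_iff] using hy0) (Subtype.ext hxy)
    have hw : algebraMap K Ω t / y ∈ IntermediateField.adjoin k {z : Ω | z ^ (Λ * n) = 1} := by
      have : AddSubmonoid.closure _ ≤ (IntermediateField.adjoin k
          {z : Ω | z ^ (Λ * n) = 1}).toSubfield.toAddSubgroup.toAddSubmonoid.comap
          (IntermediateField.adjoin K {z : Ω | z ^ (Λ * n) = 1}).val.toRingHom.toAddMonoidHom :=
        (AddSubmonoid.closure_le).2 fun z hz =>
          IntermediateField.subset_adjoin k _ (congrArg Subtype.val (show z ^ (Λ * n) = 1 from hz))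
      exact this htmem
    have hpow : (y / algebraMap K Ω t) ^ (Λ * n) = algebraMap K Ω (x / t ^ (Λ * n)) := by
      rw [div_pow, hxy, map_div₀, map_pow]
    have hw' := inv_mem hw
    rw [inv_div] at hw'
    obtain ⟨b, hb⟩ := h (Λ * n) hN (x / t ^ (Λ * n)) (hpow ▸ pow_mem hw' _)
    obtain ⟨v, hv⟩ := H b (by rintro rfl; simp [hx, ht, eq_comm] at hb)
      ⟨_, hw', by rw [hpow, ← hb, ← IsScalarTower.algebraMap_apply]⟩
    refine ⟨t ^ Λ * algebraMap k K v, ?_⟩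
    rw [mul_pow, ← map_pow, hv, hb, ← pow_mul, mul_div_cancel₀ _ (pow_ne_zero _ ht)]

/-- Let `K` be a field of characteristic 0 whose maximal abelian subextension `K_ab` over `ℚ`
is finite (realized as a field `Kab` whose image in `K` is `maxAb K`). Then `K` and `K_ab`
have the same Chevalley–Bass number (both computed inside an algebraic closure `Ω` of `K`). -/
theorem stmt_13 (K Ω Kab : Type*) [Field K] [CharZero K] [Field Ω] [Algebra K Ω]
    [IsAlgClosed Ω] [Algebra.IsAlgebraic K Ω]
    [Field Kab] [CharZero Kab] [Algebra Kab K] [Algebra Kab Ω] [IsScalarTower Kab K Ω]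
    [IsScalarTower ℚ Kab K]
    (hab : (algebraMap Kab K).fieldRange = (maxAb K).toSubfield)
    (hfin : FiniteDimensional ℚ Kab) :
    chevalleyBass K Ω = chevalleyBass Kab Ω := by
  rw [maxAb_eq_maxAbelian] at hab
  have hmem {a : K} (ha : a ∈ maxAbelian ℚ K) : ∃ b : Kab, algebraMap Kab K b = a := by
    rwa [← RingHom.mem_fieldRange, hab]
  have : CharZero Ω := charZero_of_injective_algebraMap (algebraMap K Ω).injective
  rw [chevalleyBass, chevalleyBass, cbSet_eq_of_tower Kab K Ω]
  refine fun N hN a ha => hmem (mem_maxAbelian_of_mem_adjoin (Ω := Ω) hN ?_)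
  refine (IntermediateField.adjoin_le_subfield _ _ ?_ ?_ :
    _ ≤ (IntermediateField.adjoin (maxAbelian ℚ K) {z : Ω | z ^ N = 1}).toSubfield) ha
  · rintro _ ⟨b, rfl⟩
    have hb : algebraMap Kab K b ∈ (maxAbelian ℚ K).toSubfield := hab ▸ ⟨b, rfl⟩
    rw [IsScalarTower.algebraMap_apply Kab K Ω]
    exact IntermediateField.algebraMap_mem _ (⟨_, hb⟩ : maxAbelian ℚ K)
  · exact IntermediateField.subset_adjoin _ _
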